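/- Let H be a nontrivial complex Hilbert space, A a bounded self-adjoint operator on H (A = A*), I a countable index set, and g : I → H such that Aⁿ g_i ≠ 0 for every i ∈ I and every n ∈ ℕ. Then the normalized iterated system {Aⁿ g_i / ‖Aⁿ g_i‖ : i ∈ I, n ≥ 0} is not a frame for H: there do not exist constants 0 < c ≤ C with c‖f‖² ≤ ∑_{i∈I} ∑_{n=0}^∞ |⟨f, Aⁿ g_i / ‖Aⁿ g_i‖⟩|² ≤ C‖f‖² for all f ∈ H. -/

import Mathlib

open scoped InnerProductSpace
open Filter Topology

lemma aux_inner {H : Type*} [NormedAddCommGroup H] [InnerProductSpace ℂ H] [CompleteSpace H]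
    (A : H →L[ℂ] H) (hA : ContinuousLinearMap.adjoint A = A) (v : H) (k : ℕ) :
    ∀ n, ⟪(A ^ n) v, (A ^ (n + 2 * k)) v⟫_ℂ = ⟪(A ^ (n + k)) v, (A ^ (n + k)) v⟫_ℂ := by
  induction k with
  | zero => intro n; simp
  | succ k ih =>
    intro n
    have h := ih (n + 1)
    have e1 : n + 2 * (k + 1) = (n + 1 + 2 * k) + 1 := by ring
    have e2 : n + (k + 1) = n + 1 + k := by ring
    rw [e1, e2, ← h, pow_succ' A (n + 1 + 2 * k), pow_succ' A n]
    change ⟪(A ^ n) v, A ((A ^ (n + 1 + 2 * k)) v)⟫_ℂ = ⟪A ((A ^ n) v), (A ^ (n + 1 + 2 * k)) v⟫_ℂ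
    rw [← ContinuousLinearMap.adjoint_inner_right A, hA]

lemma aux_ratio (a : ℕ → ℝ) (L : ℝ) (ha : ∀ n, 0 < a n) (hL : ∀ n, a (n + 1) ≤ L * a n)
    (hc : ∀ n, a (n + 1) ^ 2 ≤ a n * a (n + 2)) (k : ℕ) :
    Tendsto (fun n => a (n + k) ^ 2 / (a n * a (n + 2 * k))) atTop (𝓝 1) := by
  have hm : Monotone (fun n => a (n + 1) / a n) := by
    refine monotone_nat_of_le_succ fun n => ?_
    rw [div_le_div_iff₀ (ha _) (ha _)]
    have := hc n
    nlinarith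
  have hb : BddAbove (Set.range (fun n => a (n + 1) / a n)) := by
    refine ⟨L, ?_⟩
    rintro _ ⟨n, rfl⟩
    exact (div_le_iff₀ (ha _)).2 (hL n)
  have hr := tendsto_atTop_ciSup hm hb
  set r := ⨆ n, a (n + 1) / a n with hrdef
  have hr0 : 0 < r := lt_of_lt_of_le (div_pos (ha 1) (ha 0)) (le_ciSup hb 0)
  have hp : ∀ k, Tendsto (fun n => a (n + k) / a n) atTop (𝓝 (r ^ k)) := by
    intro k
    induction k with
    | zero =>
      simp only [add_zero, pow_zero]
      exact tendsto_const_nhds.congr fun n => (div_self (ha n).ne').symm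
    | succ k ih =>
      have h2 := (hr.comp (tendsto_add_atTop_nat k)).mul ih
      rw [pow_succ']
      refine h2.congr fun n => ?_
      have := (ha (n + k)).ne'
      have := (ha n).ne'
      simp only [Function.comp]
      rw [← add_assoc]
      field_simp
  have h := ((hp k).pow 2).div (hp (2 * k)) (pow_pos hr0 _).ne'
  have e : (r ^ k) ^ 2 / r ^ (2 * k) = 1 := by
    rw [← pow_mul, mul_comm k 2]
    exact div_self (pow_pos hr0 _).ne'
  rw [e] at h
  refine h.congr fun n => ?_
  have := (ha (n + 2 * k)).ne'
  have := (ha n).ne'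
  simp only [Pi.div_apply]
  field_simp

lemma aux_not_bessel {H : Type*} [NormedAddCommGroup H] [InnerProductSpace ℂ H] [CompleteSpace H]
    (A : H →L[ℂ] H) (hA : ContinuousLinearMap.adjoint A = A) (v : H)
    (hv : ∀ n : ℕ, (A ^ n) v ≠ 0) (δ K : ℝ) (hδ : 0 < δ)
    (hB : ∀ h : H, ‖h‖ ≤ δ → ∀ s : Finset ℕ,
      ∑ n ∈ s, ‖⟪h, (‖(A ^ n) v‖⁻¹ : ℝ) • (A ^ n) v⟫_ℂ‖ ^ 2 ≤ K) : False := by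
  have ha : ∀ n, 0 < ‖(A ^ n) v‖ := fun n => norm_pos_iff.2 (hv n)
  have hin : ∀ n k, ‖⟪(A ^ n) v, (A ^ (n + 2 * k)) v⟫_ℂ‖ = ‖(A ^ (n + k)) v‖ ^ 2 := by
    intro n k
    rw [aux_inner A hA, inner_self_eq_norm_sq_to_K]
    simp
  have key := aux_ratio (fun n => ‖(A ^ n) v‖) ‖A‖ ha
    (fun n => by
      simp only [pow_succ' A n]
      exact A.le_opNorm _)
    (fun n => by
      have := hin n 1
      rw [mul_one] at this
      rw [← this]
      exact norm_inner_le_norm _ _)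
  have hle : ∀ m : ℕ, δ ^ 2 * (m : ℝ) ≤ K := by
    intro m
    have ht : Tendsto (fun n => δ ^ 2 * ∑ k ∈ Finset.range m,
        (‖(A ^ (n + k)) v‖ ^ 2 / (‖(A ^ n) v‖ * ‖(A ^ (n + 2 * k)) v‖)) ^ 2) atTop
        (𝓝 (δ ^ 2 * ∑ k ∈ Finset.range m, (1 : ℝ) ^ 2)) :=
      (tendsto_finsetSum _ fun k _ => (key k).pow 2).const_mul _
    have hs : ∑ k ∈ Finset.range m, (1 : ℝ) ^ 2 = m := by simp
    rw [hs] at ht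
    refine le_of_tendsto' ht fun n => ?_
    have h1 := hB ((δ * ‖(A ^ n) v‖⁻¹ : ℝ) • (A ^ n) v)
      (by
        rw [norm_smul, Real.norm_of_nonneg (by positivity), mul_assoc,
          inv_mul_cancel₀ (ha n).ne', mul_one])
      ((Finset.range m).image fun k => n + 2 * k)
    rw [Finset.sum_image (by intro x _ y _ h; simp only at h; omega)] at h1
    refine le_trans (le_of_eq ?_) h1
    rw [Finset.mul_sum]
    refine Finset.sum_congr rfl fun k _ => ?_
    rw [← Complex.coe_smul, ← Complex.coe_smul, inner_smul_left, inner_smul_right, norm_mul, norm_mul, hin]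
    have := (ha n).ne'
    have := (ha (n + 2 * k)).ne'
    rw [Complex.conj_ofReal, Complex.norm_real, Complex.norm_real, Real.norm_of_nonneg (by positivity), Real.norm_of_nonneg (by positivity)]
    field_simp
  obtain ⟨m, hm⟩ := exists_nat_gt (K / δ ^ 2)
  have h1 := hle m
  rw [div_lt_iff₀ (by positivity)] at hm
  linarith



/-- For a bounded self-adjoint operator `A` on a nontrivial complex Hilbert space `H`,
the normalized iterated system `{Aⁿ gᵢ / ‖Aⁿ gᵢ‖}` is never a frame for `H`. -/
theorem normalized_iterated_system_not_frame_of_selfAdjoint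
    {H : Type*} [NormedAddCommGroup H] [InnerProductSpace ℂ H] [CompleteSpace H] [Nontrivial H]
    {I : Type*} [Countable I] (A : H →L[ℂ] H) (hA : ContinuousLinearMap.adjoint A = A)
    (g : I → H) (hg : ∀ (i : I) (n : ℕ), (A ^ n) (g i) ≠ 0) :
    ¬ ∃ c C : ℝ, 0 < c ∧ c ≤ C ∧ ∀ f : H,
      c * ‖f‖ ^ 2 ≤ ∑' i : I, ∑' n : ℕ, ‖⟪f, (‖(A ^ n) (g i)‖⁻¹ : ℝ) • (A ^ n) (g i)⟫_ℂ‖ ^ 2 ∧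
      ∑' i : I, ∑' n : ℕ, ‖⟪f, (‖(A ^ n) (g i)‖⁻¹ : ℝ) • (A ^ n) (g i)⟫_ℂ‖ ^ 2 ≤ C * ‖f‖ ^ 2 := by

  rintro ⟨c, C, hc, -, h⟩
  rcases isEmpty_or_nonempty I with hI | hI
  · obtain ⟨f, hf⟩ := exists_ne (0 : H)
    have h1 := (h f).1
    rw [tsum_empty] at h1
    have : 0 < c * ‖f‖ ^ 2 := mul_pos hc (pow_pos (norm_pos_iff.2 hf) 2)
    linarith
  set e : I → ℕ → H := fun i n => (‖(A ^ n) (g i)‖⁻¹ : ℝ) • (A ^ n) (g i) with he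
  have hex : ∀ f : H, ∃ i, Summable fun n => ‖⟪f, e i n⟫_ℂ‖ ^ 2 := by
    intro f
    by_contra! hn
    have hf : f ≠ 0 := by
      rintro rfl
      exact hn hI.some (by simp)
    have h1 : c * ‖f‖ ^ 2 ≤ ∑' i : I, ∑' n : ℕ, ‖⟪f, e i n⟫_ℂ‖ ^ 2 := (h f).1
    have h2 : ∀ i, ∑' n : ℕ, ‖⟪f, e i n⟫_ℂ‖ ^ 2 = 0 := fun i =>
      tsum_eq_zero_of_not_summable (hn i)
    simp only [h2, tsum_zero] at h1
    have : 0 < c * ‖f‖ ^ 2 := mul_pos hc (pow_pos (norm_pos_iff.2 hf) 2)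
    linarith
  let B : I × ℕ → Set H := fun p => {f | ∀ s : Finset ℕ, ∑ n ∈ s, ‖⟪f, e p.1 n⟫_ℂ‖ ^ 2 ≤ p.2}
  have hBc : ∀ p, IsClosed (B p) := by
    intro p
    simp only [B, Set.ofPred_forall]
    exact isClosed_iInter fun s => isClosed_le (by fun_prop) continuous_const
  have hBu : ⋃ p, B p = Set.univ := by
    refine Set.eq_univ_of_forall fun f => ?_
    obtain ⟨i, hi⟩ := hex f
    obtain ⟨M, hM⟩ := exists_nat_ge (∑' n, ‖⟪f, e i n⟫_ℂ‖ ^ 2)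
    exact Set.mem_iUnion.2 ⟨(i, M), fun s =>
      (hi.sum_le_tsum s fun n _ => sq_nonneg _).trans hM⟩
  obtain ⟨⟨i, M⟩, f0, hf0⟩ := nonempty_interior_of_iUnion_of_closed hBc hBu
  obtain ⟨δ, hδ, hball⟩ := Metric.isOpen_iff.1 isOpen_interior f0 hf0
  refine aux_not_bessel A hA (g i) (hg i) (δ / 2) (4 * M) (by positivity) fun x hx s => ?_
  have h0 : ∑ n ∈ s, ‖⟪f0, e i n⟫_ℂ‖ ^ 2 ≤ M := interior_subset hf0 s
  have h1 : ∑ n ∈ s, ‖⟪f0 + x, e i n⟫_ℂ‖ ^ 2 ≤ M := by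
    refine interior_subset (hball ?_) s
    rw [Metric.mem_ball, dist_eq_norm, add_sub_cancel_left]
    linarith
  have h2 : ∑ n ∈ s, ‖⟪x, e i n⟫_ℂ‖ ^ 2 ≤
      ∑ n ∈ s, (2 * ‖⟪f0 + x, e i n⟫_ℂ‖ ^ 2 + 2 * ‖⟪f0, e i n⟫_ℂ‖ ^ 2) := by
    refine Finset.sum_le_sum fun n _ => ?_
    have h3 : ⟪x, e i n⟫_ℂ = ⟪f0 + x, e i n⟫_ℂ - ⟪f0, e i n⟫_ℂ := by
      rw [inner_add_left]; ring
    have h4 := norm_sub_le ⟪f0 + x, e i n⟫_ℂ ⟪f0, e i n⟫_ℂ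
    rw [← h3] at h4
    nlinarith [norm_nonneg ⟪x, e i n⟫_ℂ,
      sq_nonneg (‖⟪f0 + x, e i n⟫_ℂ‖ - ‖⟪f0, e i n⟫_ℂ‖)]
  rw [Finset.sum_add_distrib, ← Finset.mul_sum, ← Finset.mul_sum] at h2
  change ∑ n ∈ s, ‖⟪x, e i n⟫_ℂ‖ ^ 2 ≤ 4 * M
  linarith
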